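/- Let P be a probability distribution on a finite set S, let f : S → [0,H], let Y_1, …, Y_n be i.i.d. samples from P with n ≥ 2, and let P̂ be the empirical distribution. Then for any δ ∈ (0,1), with probability at least 1 − δ, | Σ_y (P(y) − P̂(y))·f(y) | ≤ √( 2·V̂·ln(2/δ) / n ) + 7·H·ln(2/δ)/(3·n), where V̂ = Var_{Y∼P̂}(f(Y)) is the empirical variance of f under P̂. -/

import Mathlib

open scoped Classical

namespace EmpiricalBernstein

section Probability

variable {S : Type*} [Fintype S]

/-- The probability of the event `A` under the `n`-fold product of the weights `P`. -/
noncomputable def prodProb (P : S → ℝ) {n : ℕ} (A : (Fin n → S) → Prop) : ℝ :=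
  ∑ ω, if A ω then ∏ i, P (ω i) else 0

variable {P : S → ℝ} {n : ℕ}

lemma prodProb_mono (hP : ∀ y, 0 ≤ P y) {A B : (Fin n → S) → Prop} (h : ∀ ω, A ω → B ω) :
    prodProb P A ≤ prodProb P B := by
  refine Finset.sum_le_sum fun ω _ => ?_
  have := Finset.prod_nonneg fun i (_ : i ∈ Finset.univ) => hP (ω i)
  by_cases hA : A ω
  · simp [hA, h ω hA]
  · by_cases hB : B ω <;> simp [hA, hB, this]

lemma prodProb_or_le (hP : ∀ y, 0 ≤ P y) (A B : (Fin n → S) → Prop) :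
    prodProb P (fun ω => A ω ∨ B ω) ≤ prodProb P A + prodProb P B := by
  unfold prodProb
  rw [← Finset.sum_add_distrib]
  refine Finset.sum_le_sum fun ω _ => ?_
  have := Finset.prod_nonneg fun i (_ : i ∈ Finset.univ) => hP (ω i)
  by_cases hA : A ω <;> by_cases hB : B ω <;> simp [hA, hB, this]

lemma prodProb_compl (hP1 : ∑ y, P y = 1) (A : (Fin n → S) → Prop) :
    prodProb P A = 1 - prodProb P (fun ω => ¬ A ω) := by
  have h1 : ∑ ω : Fin n → S, ∏ i, P (ω i) = 1 := by
    have := Finset.prod_univ_sum (fun _ : Fin n => (Finset.univ : Finset S)) (fun _ y => P y)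
    rw [Fintype.piFinset_univ] at this
    rw [← this]; simp [hP1]
  rw [← h1, eq_sub_iff_add_eq]
  unfold prodProb
  rw [← Finset.sum_add_distrib]
  refine Finset.sum_congr rfl fun ω _ => ?_
  by_cases hA : A ω <;> simp [hA]

/-- Chernoff's bound for a sum of i.i.d. terms `g (ω i)`. -/
lemma prodProb_le_exp (hP : ∀ y, 0 ≤ P y) (g : S → ℝ) {a b : ℝ}
    (hg : ∑ y, P y * Real.exp (g y) ≤ Real.exp b) {A : (Fin n → S) → Prop}
    (hA : ∀ ω, A ω → n * b + a ≤ ∑ i, g (ω i)) :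
    prodProb P A ≤ Real.exp (-a) := by
  have hmgf : ∑ ω : Fin n → S, ∏ i, (P (ω i) * Real.exp (g (ω i)))
      = (∑ y, P y * Real.exp (g y)) ^ n := by
    have := Finset.prod_univ_sum (fun _ : Fin n => (Finset.univ : Finset S))
      (fun _ y => P y * Real.exp (g y))
    rw [Fintype.piFinset_univ] at this
    rw [← this]; simp
  calc prodProb P A
      ≤ ∑ ω : Fin n → S, Real.exp (-(n * b + a)) * ∏ i, (P (ω i) * Real.exp (g (ω i))) := by
        refine Finset.sum_le_sum fun ω _ => ?_
        have h0 := Finset.prod_nonneg fun i (_ : i ∈ Finset.univ) => hP (ω i)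
        rw [Finset.prod_mul_distrib, ← Real.exp_sum]
        by_cases h : A ω
        · have h1 : 1 ≤ Real.exp (-(n * b + a)) * Real.exp (∑ i, g (ω i)) := by
            rw [← Real.exp_add]
            exact Real.one_le_exp (by linarith [hA ω h])
          simp only [h, if_true]
          nlinarith [mul_le_mul_of_nonneg_left h1 h0]
        · simp only [h, if_false]
          positivity
    _ = Real.exp (-(n * b + a)) * (∑ y, P y * Real.exp (g y)) ^ n := by
        rw [← Finset.mul_sum, hmgf]
    _ ≤ Real.exp (-(n * b + a)) * Real.exp b ^ n := by
        gcongr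
        exact Finset.sum_nonneg fun y _ => mul_nonneg (hP y) (Real.exp_pos _).le
    _ = Real.exp (-a) := by
        rw [← Real.exp_nat_mul, ← Real.exp_add]; congr 1; ring

end Probability

section MomentGenerating

lemma antitone_one_sub_mul_exp :
    Antitone fun x : ℝ => (1 - x) * Real.exp (x + x ^ 2 / 2) := by
  have hd : ∀ x : ℝ, HasDerivAt (fun x : ℝ => (1 - x) * Real.exp (x + x ^ 2 / 2))
      (-(x ^ 2 * Real.exp (x + x ^ 2 / 2))) x := by
    intro x
    have h1 : HasDerivAt (fun x : ℝ => x + x ^ 2 / 2) (1 + x) x := by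
      refine ((hasDerivAt_id' x).fun_add ((hasDerivAt_pow 2 x).div_const 2)).congr_deriv ?_
      norm_num
    refine (((hasDerivAt_id' x).const_sub 1).fun_mul h1.exp).congr_deriv ?_
    ring
  refine antitone_of_deriv_nonpos (fun x => (hd x).differentiableAt) fun x => ?_
  rw [(hd x).deriv]
  have := Real.exp_pos (x + x ^ 2 / 2)
  nlinarith [sq_nonneg x, mul_nonneg (sq_nonneg x) this.le]

lemma exp_sub_sq_le_of_nonneg {y : ℝ} (hy : 0 ≤ y) : Real.exp (y - y ^ 2 / 2) ≤ 1 + y := by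
  have h := antitone_one_sub_mul_exp (show -y ≤ 0 by linarith)
  have he : Real.exp (-y + (-y) ^ 2 / 2) * Real.exp (y - y ^ 2 / 2) = 1 := by
    rw [← Real.exp_add]; ring_nf; exact Real.exp_zero
  simp only [sub_zero, sub_neg_eq_add] at h
  norm_num at h
  rw [show (-y) ^ 2 = y ^ 2 by ring] at he
  have := mul_le_mul_of_nonneg_right h (Real.exp_pos (y - y ^ 2 / 2)).le
  rw [mul_assoc, he] at this
  linarith

lemma one_sub_le_exp_neg_sub_sq {x : ℝ} (hx : 0 ≤ x) :
    1 - x ≤ Real.exp (-x - x ^ 2 / 2) := by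
  have h := antitone_one_sub_mul_exp hx
  have he : Real.exp (x + x ^ 2 / 2) * Real.exp (-x - x ^ 2 / 2) = 1 := by
    rw [← Real.exp_add]; ring_nf; exact Real.exp_zero
  norm_num at h
  have := mul_le_mul_of_nonneg_right h (Real.exp_pos (-x - x ^ 2 / 2)).le
  rw [mul_assoc, he] at this
  linarith

lemma exp_neg_sub_sq_le {z : ℝ} (hz : 0 ≤ z) :
    Real.exp (-z - z ^ 2 / 2) ≤ 1 - z + z ^ 3 / 3 := by
  have hd : ∀ x : ℝ, HasDerivAt (fun x : ℝ => 1 - x + x ^ 3 / 3 - Real.exp (-x - x ^ 2 / 2))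
      (-1 + x ^ 2 + (1 + x) * Real.exp (-x - x ^ 2 / 2)) x := by
    intro x
    have h1 : HasDerivAt (fun x : ℝ => -x - x ^ 2 / 2) (-1 - x) x := by
      refine ((hasDerivAt_id' x).fun_neg.fun_sub ((hasDerivAt_pow 2 x).div_const 2)).congr_deriv ?_
      norm_num
    have h2 : HasDerivAt (fun x : ℝ => 1 - x + x ^ 3 / 3) (-1 + x ^ 2) x := by
      refine (((hasDerivAt_id' x).const_sub 1).fun_add
        ((hasDerivAt_pow 3 x).div_const 3)).congr_deriv ?_
      norm_num
    refine (h2.fun_sub h1.exp).congr_deriv ?_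
    ring
  have hmono := monotoneOn_of_deriv_nonneg (convex_Ici (0 : ℝ))
      (fun x _ => (hd x).continuousAt.continuousWithinAt)
      (fun x _ => (hd x).differentiableAt.differentiableWithinAt) fun x hx => by
    rw [interior_Ici] at hx
    have hx : 0 < x := hx
    rw [(hd x).deriv]
    nlinarith [one_sub_le_exp_neg_sub_sq hx.le]
  have := hmono (Set.mem_Ici.2 le_rfl) (Set.mem_Ici.2 hz) hz
  norm_num at this
  linarith

lemma exp_sub_sq_le (y : ℝ) : Real.exp (y - y ^ 2 / 2) ≤ 1 + y + |y| ^ 3 / 3 := by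
  rcases le_total 0 y with hy | hy
  · have : 0 ≤ |y| ^ 3 / 3 := by positivity
    linarith [exp_sub_sq_le_of_nonneg hy]
  · have h := exp_neg_sub_sq_le (z := -y) (by linarith)
    rw [abs_of_nonpos hy]
    convert h using 2 <;> ring

variable {S : Type*} [Fintype S] {P X : S → ℝ}

lemma sum_mul_exp_le_of_forall_le (hP : ∀ y, 0 ≤ P y) (hP1 : ∑ y, P y = 1)
    (hX0 : ∑ y, P y * X y = 0) {g : S → ℝ} {a b : ℝ}
    (h : ∀ y, Real.exp (g y) ≤ 1 + a * X y + b * X y ^ 2) :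
    ∑ y, P y * Real.exp (g y) ≤ Real.exp (b * ∑ y, P y * X y ^ 2) :=
  calc ∑ y, P y * Real.exp (g y)
      ≤ ∑ y, (P y + a * (P y * X y) + b * (P y * X y ^ 2)) :=
        Finset.sum_le_sum fun y _ =>
          (mul_le_mul_of_nonneg_left (h y) (hP y)).trans (by ring_nf; rfl)
    _ = b * (∑ y, P y * X y ^ 2) + 1 := by
        rw [Finset.sum_add_distrib, Finset.sum_add_distrib, ← Finset.mul_sum, ← Finset.mul_sum,
          hX0, hP1]
        ring
    _ ≤ _ := Real.add_one_le_exp _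

lemma sum_mul_exp_mul_le (hP : ∀ y, 0 ≤ P y) (hP1 : ∑ y, P y = 1) (hX : ∀ y, |X y| ≤ 1)
    (hX0 : ∑ y, P y * X y = 0) {t : ℝ} (ht0 : 0 ≤ t) (ht1 : t ≤ 1) :
    ∑ y, P y * Real.exp (t * X y) ≤ Real.exp (t ^ 2 * ∑ y, P y * X y ^ 2) := by
  refine sum_mul_exp_le_of_forall_le (a := t) hP hP1 hX0 fun y => ?_
  have h1 : |t * X y| ≤ 1 := by
    rw [abs_mul, abs_of_nonneg ht0]
    nlinarith [hX y, abs_nonneg (X y)]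
  have := (abs_le.1 (Real.abs_exp_sub_one_sub_id_le h1)).2
  nlinarith

lemma sum_mul_exp_sub_sq_le (hP : ∀ y, 0 ≤ P y) (hP1 : ∑ y, P y = 1) (hX : ∀ y, |X y| ≤ 1)
    (hX0 : ∑ y, P y * X y = 0) {t : ℝ} (ht0 : 0 ≤ t) :
    ∑ y, P y * Real.exp (t * X y - t ^ 2 / 2 * X y ^ 2)
      ≤ Real.exp (t ^ 3 / 3 * ∑ y, P y * X y ^ 2) := by
  refine sum_mul_exp_le_of_forall_le (a := t) hP hP1 hX0 fun y => ?_
  have h := exp_sub_sq_le (t * X y)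
  rw [abs_mul, abs_of_nonneg ht0, mul_pow t |X y|] at h
  have h3 : |X y| ^ 3 ≤ X y ^ 2 := by
    rw [← sq_abs (X y)]
    nlinarith [hX y, abs_nonneg (X y), sq_nonneg |X y|]
  have := mul_le_mul_of_nonneg_left h3 (pow_nonneg ht0 3)
  calc Real.exp (t * X y - t ^ 2 / 2 * X y ^ 2)
      = Real.exp (t * X y - (t * X y) ^ 2 / 2) := by ring_nf
    _ ≤ _ := by linarith

lemma sum_mul_exp_mul_sq_le (hP : ∀ y, 0 ≤ P y) (hP1 : ∑ y, P y = 1) (hX : ∀ y, |X y| ≤ 1)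
    (hX0 : ∑ y, P y * X y = 0) (t : ℝ) :
    ∑ y, P y * Real.exp (t * X y ^ 2)
      ≤ Real.exp ((Real.exp t - 1) * ∑ y, P y * X y ^ 2) := by
  refine sum_mul_exp_le_of_forall_le (a := 0) hP hP1 hX0 fun y => ?_
  have h1 : X y ^ 2 ≤ 1 := by
    rw [← sq_abs]; nlinarith [hX y, abs_nonneg (X y)]
  have := convexOn_exp.2 (Set.mem_univ t) (Set.mem_univ (0 : ℝ)) (sq_nonneg (X y))
    (sub_nonneg.2 h1) (by ring)
  simp only [smul_eq_mul, mul_zero, add_zero, Real.exp_zero, mul_one] at this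
  rw [mul_comm t]
  linarith

end MomentGenerating

section Deviation

variable {S : Type*} [Fintype S]

/-- `X` is centered with values in `[-1, 1]` under the probability weights `P`. -/
structure IsCentered (P X : S → ℝ) : Prop where
  nonneg : ∀ y, 0 ≤ P y
  sum_eq_one : ∑ y, P y = 1
  abs_le_one : ∀ y, |X y| ≤ 1
  mean_eq_zero : ∑ y, P y * X y = 0

/-- The normalized sum `s = (∑ X) / L` exceeds `c` although `2 z ≤ (s - c) ^ 2 + ρ s ^ 2`, where
`z = (∑ X ^ 2) / L`. -/
def LargeDeviation (X : S → ℝ) (L c ρ : ℝ) {n : ℕ} (ω : Fin n → S) : Prop :=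
  c ≤ (∑ i, X (ω i)) / L ∧
    2 * ((∑ i, X (ω i) ^ 2) / L) ≤
      ((∑ i, X (ω i)) / L - c) ^ 2 + ρ * ((∑ i, X (ω i)) / L) ^ 2

variable {P X : S → ℝ} {n : ℕ} {L u : ℝ}

lemma exp_neg_mul_one_add_le (hL : Real.log 2 ≤ L) {r : ℝ} (hr : 0 ≤ r) :
    Real.exp (-(L * (1 + r))) ≤ Real.exp (-L) * Real.exp (-(Real.log 2 * r)) := by
  rw [← Real.exp_add]
  exact Real.exp_le_exp.2 (by nlinarith)

lemma IsCentered.prodProb_sum_sq_lt_le (h : IsCentered P X) (hL : Real.log 2 ≤ L)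
    (hu : n * ∑ y, P y * X y ^ 2 = u * L) {z t r : ℝ} (ht : 0 ≤ t) (hr : 0 ≤ r)
    (hz : 1 + r ≤ u * (1 - Real.exp (-t)) - t * z) :
    prodProb P (fun ω : Fin n → S => (∑ i, X (ω i) ^ 2) / L < z) ≤
      Real.exp (-L) * Real.exp (-(Real.log 2 * r)) := by
  have hL0 : 0 < L := (Real.log_pos one_lt_two).trans_le hL
  refine (prodProb_le_exp h.nonneg _ (sum_mul_exp_mul_sq_le h.nonneg h.sum_eq_one h.abs_le_one
    h.mean_eq_zero (-t)) fun ω hω => ?_).trans (exp_neg_mul_one_add_le hL hr)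
  rw [div_lt_iff₀ hL0] at hω
  rw [← Finset.mul_sum, mul_left_comm, hu]
  nlinarith [mul_le_mul_of_nonneg_left hz hL0.le, mul_le_mul_of_nonneg_left hω.le ht]

lemma IsCentered.prodProb_lt_sum_sq_le (h : IsCentered P X) (hL : Real.log 2 ≤ L)
    (hu : n * ∑ y, P y * X y ^ 2 = u * L) {z t r : ℝ} (ht : 0 ≤ t) (hr : 0 ≤ r)
    (hz : 1 + r ≤ t * z - u * (Real.exp t - 1)) :
    prodProb P (fun ω : Fin n → S => z < (∑ i, X (ω i) ^ 2) / L) ≤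
      Real.exp (-L) * Real.exp (-(Real.log 2 * r)) := by
  have hL0 : 0 < L := (Real.log_pos one_lt_two).trans_le hL
  refine (prodProb_le_exp h.nonneg _ (sum_mul_exp_mul_sq_le h.nonneg h.sum_eq_one h.abs_le_one
    h.mean_eq_zero t) fun ω hω => ?_).trans (exp_neg_mul_one_add_le hL hr)
  rw [lt_div_iff₀ hL0] at hω
  rw [← Finset.mul_sum, mul_left_comm, hu]
  nlinarith [mul_le_mul_of_nonneg_left hz hL0.le, mul_le_mul_of_nonneg_left hω.le ht]

lemma IsCentered.prodProb_le_of_tilt (h : IsCentered P X) (hL : Real.log 2 ≤ L)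
    (hu : n * ∑ y, P y * X y ^ 2 = u * L) {t r : ℝ} (ht : 0 ≤ t) (hr : 0 ≤ r) :
    prodProb P (fun ω : Fin n → S => 1 + r + t ^ 3 * u / 3 ≤
        t * ((∑ i, X (ω i)) / L) - t ^ 2 * ((∑ i, X (ω i) ^ 2) / L) / 2) ≤
      Real.exp (-L) * Real.exp (-(Real.log 2 * r)) := by
  have hL0 : 0 < L := (Real.log_pos one_lt_two).trans_le hL
  refine (prodProb_le_exp h.nonneg _ (sum_mul_exp_sub_sq_le h.nonneg h.sum_eq_one h.abs_le_one
    h.mean_eq_zero ht) fun ω hω => ?_).trans (exp_neg_mul_one_add_le hL hr)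
  rw [Finset.sum_sub_distrib, ← Finset.mul_sum, ← Finset.mul_sum]
  have h1 : (∑ i, X (ω i)) / L * L = ∑ i, X (ω i) := div_mul_cancel₀ _ hL0.ne'
  have h2 : (∑ i, X (ω i) ^ 2) / L * L = ∑ i, X (ω i) ^ 2 := div_mul_cancel₀ _ hL0.ne'
  rw [← h1, ← h2]
  calc n * (t ^ 3 / 3 * ∑ y, P y * X y ^ 2) + L * (1 + r)
      = (1 + r + t ^ 3 * u / 3) * L := by linear_combination t ^ 3 / 3 * hu
    _ ≤ _ := mul_le_mul_of_nonneg_right hω hL0.le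
    _ = _ := by ring

/-- Splitting a large deviation according to the size of `∑ X ^ 2`. -/
lemma IsCentered.prodProb_largeDeviation_le (h : IsCentered P X) (hL : Real.log 2 ≤ L)
    (hu : n * ∑ y, P y * X y ^ 2 = u * L) {c ρ t ε zm zp βm βp : ℝ} (ht : 0 ≤ t) (hε : 0 ≤ ε)
    (hcore : ∀ s z, c ≤ s → 2 * z ≤ (s - c) ^ 2 + ρ * s ^ 2 → zm ≤ z → z ≤ zp →
      1 + ε + t ^ 3 * u / 3 ≤ t * s - t ^ 2 * z / 2)
    (hm : prodProb P (fun ω : Fin n → S => (∑ i, X (ω i) ^ 2) / L < zm) ≤ Real.exp (-L) * βm)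
    (hp : prodProb P (fun ω : Fin n → S => zp < (∑ i, X (ω i) ^ 2) / L) ≤ Real.exp (-L) * βp)
    (hsum : Real.exp (-(Real.log 2 * ε)) + βm + βp ≤ 1) :
    prodProb P (LargeDeviation X L c ρ (n := n)) ≤ Real.exp (-L) := by
  have hsub : prodProb P (LargeDeviation X L c ρ (n := n)) ≤
      prodProb P (fun ω : Fin n → S => (1 + ε + t ^ 3 * u / 3 ≤
        t * ((∑ i, X (ω i)) / L) - t ^ 2 * ((∑ i, X (ω i) ^ 2) / L) / 2 ∨
        (∑ i, X (ω i) ^ 2) / L < zm) ∨ zp < (∑ i, X (ω i) ^ 2) / L) := by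
    refine prodProb_mono h.nonneg fun ω hω => ?_
    by_contra! hcon
    exact hcon.1.1.not_ge (hcore _ _ hω.1 hω.2 hcon.1.2 hcon.2)
  have h1 := hsub.trans (prodProb_or_le h.nonneg _ _)
  have h2 := prodProb_or_le h.nonneg (fun ω : Fin n → S => 1 + ε + t ^ 3 * u / 3 ≤
        t * ((∑ i, X (ω i)) / L) - t ^ 2 * ((∑ i, X (ω i) ^ 2) / L) / 2)
        (fun ω => (∑ i, X (ω i) ^ 2) / L < zm)
  have h3 := h.prodProb_le_of_tilt hL hu ht hε
  nlinarith [mul_le_mul_of_nonneg_left hsum (Real.exp_pos (-L)).le]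

lemma concave_quadratic_ge {t c ρ K a b s : ℝ} (hρ : 0 ≤ ρ) (has : a ≤ s) (hsb : s < b)
    (ha : K ≤ t * a - t ^ 2 * ((a - c) ^ 2 + ρ * a ^ 2) / 4)
    (hb : K ≤ t * b - t ^ 2 * ((b - c) ^ 2 + ρ * b ^ 2) / 4) :
    K ≤ t * s - t ^ 2 * ((s - c) ^ 2 + ρ * s ^ 2) / 4 := by
  have h1 : 0 ≤ t ^ 2 * (1 + ρ) / 4 * ((s - a) * (b - s)) :=
    mul_nonneg (by positivity) (mul_nonneg (by linarith) (by linarith))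
  have h2 := mul_le_mul_of_nonneg_left ha (show 0 ≤ b - s by linarith)
  have h3 := mul_le_mul_of_nonneg_left hb (show 0 ≤ s - a by linarith)
  refine le_of_mul_le_mul_left ?_ (show 0 < b - a by linarith)
  nlinarith [mul_nonneg h1 (show 0 ≤ b - a by linarith)]

/-- Lower bound for the tilted exponent in the central range of `z`. -/
lemma tilt_ge {t c ρ zm zp K s₁ s z : ℝ} (ht : 0 ≤ t) (hc : 0 ≤ c) (hρ : 0 ≤ ρ)
    (hright : (s₁ - c) ^ 2 + ρ * s₁ ^ 2 ≤ 2 * zp) (hK₁ : K ≤ t * s₁ - t ^ 2 * zp / 2)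
    (hleft : (∃ s₀, c ≤ s₀ ∧ (s₀ - c) ^ 2 + ρ * s₀ ^ 2 ≤ 2 * zm ∧ K ≤ t * s₀ - t ^ 2 * zm / 2) ∨
      K ≤ t * c - t ^ 2 * (ρ * c ^ 2) / 4)
    (hs : c ≤ s) (hz : 2 * z ≤ (s - c) ^ 2 + ρ * s ^ 2) (hzm : zm ≤ z) (hzp : z ≤ zp) :
    K ≤ t * s - t ^ 2 * z / 2 := by
  have ht2 : 0 ≤ t ^ 2 := sq_nonneg t
  rcases le_or_gt s₁ s with hs₁ | hs₁
  · nlinarith [mul_le_mul_of_nonneg_left hs₁ ht, mul_le_mul_of_nonneg_left hzp ht2]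
  have hb : K ≤ t * s₁ - t ^ 2 * ((s₁ - c) ^ 2 + ρ * s₁ ^ 2) / 4 := by
    nlinarith [mul_le_mul_of_nonneg_left hright ht2]
  suffices K ≤ t * s - t ^ 2 * ((s - c) ^ 2 + ρ * s ^ 2) / 4 by
    nlinarith [mul_le_mul_of_nonneg_left hz ht2]
  rcases hleft with ⟨s₀, hcs₀, hs₀, hK₀⟩ | hK₀
  · rcases le_or_gt s₀ s with h | h
    · refine concave_quadratic_ge hρ h hs₁ ?_ hb
      nlinarith [mul_le_mul_of_nonneg_left hs₀ ht2]
    · have h1 : (s - c) ^ 2 ≤ (s₀ - c) ^ 2 := by nlinarith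
      have h2 : ρ * s ^ 2 ≤ ρ * s₀ ^ 2 := mul_le_mul_of_nonneg_left (by nlinarith) hρ
      have h3 : zm = z := by linarith
      subst h3
      nlinarith [mul_le_mul_of_nonneg_left hz ht2]
  · refine concave_quadratic_ge hρ hs hs₁ ?_ hb
    simpa using hK₀

lemma sq_sub_add_le {κ ρ w c s z : ℝ} (hκ0 : 0 ≤ κ) (hκ1 : κ ≤ 1) (hρ : ρ ≤ κ * w)
    (h0 : (s - c) ^ 2 ≤ 2 * z) (h1 : (s - 2 * c) ^ 2 + w * s ^ 2 ≤ 2 * z) :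
    (s - c * (1 + κ)) ^ 2 + ρ * s ^ 2 ≤ 2 * z := by
  nlinarith [mul_le_mul_of_nonneg_left h0 (sub_nonneg.2 hκ1), mul_le_mul_of_nonneg_left h1 hκ0,
    mul_le_mul_of_nonneg_right hρ (sq_nonneg s), mul_nonneg (mul_nonneg hκ0 (sub_nonneg.2 hκ1))
    (sq_nonneg c)]

lemma exists_left_point {κ ρ w c s₀ zm K t : ℝ} (hκ0 : 0 ≤ κ) (hκ1 : κ ≤ 1) (hρ : ρ ≤ κ * w)
    (hw : 0 ≤ w) (hc : 0 < c) (hcs : c < s₀) (hsc : s₀ < 2 * c)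
    (h0 : (s₀ - c) ^ 2 ≤ 2 * zm) (h1 : w * (s₀ - c) * s₀ ^ 2 ≤ 2 * c * zm)
    (hK : K ≤ t * s₀ - t ^ 2 * zm / 2) (hK' : K + t ^ 2 * w * c ^ 2 ≤ 2 * t * c) :
    (∃ s₀, c * (1 + κ) ≤ s₀ ∧ (s₀ - c * (1 + κ)) ^ 2 + ρ * s₀ ^ 2 ≤ 2 * zm ∧
      K ≤ t * s₀ - t ^ 2 * zm / 2) ∨
      K ≤ t * (c * (1 + κ)) - t ^ 2 * (ρ * (c * (1 + κ)) ^ 2) / 4 := by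
  obtain ⟨a, rfl⟩ : ∃ a, s₀ = c * (1 + a) := ⟨s₀ / c - 1, by field_simp; ring⟩
  have ha0 : 0 < a := by nlinarith
  have ha1 : a < 1 := by nlinarith
  have h1' : a * w * (c * (1 + a)) ^ 2 ≤ 2 * zm := by
    refine le_of_mul_le_mul_left ?_ hc
    linarith
  rcases le_or_gt κ a with h | h
  · refine Or.inl ⟨c * (1 + a), by gcongr, ?_, hK⟩
    have e1 : (c * (1 + a) - c * (1 + κ)) ^ 2 = (c * (a - κ)) ^ 2 := by ring
    have e2 : (c * (1 + a) - c) ^ 2 = (c * a) ^ 2 := by ring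
    rw [e2] at h0
    rw [e1]
    have h2 : ρ * (c * (1 + a)) ^ 2 ≤ κ * w * (c * (1 + a)) ^ 2 :=
      mul_le_mul_of_nonneg_right hρ (sq_nonneg _)
    refine le_of_mul_le_mul_left ?_ ha0
    nlinarith [mul_le_mul_of_nonneg_left h0 (sub_nonneg.2 h),
      mul_le_mul_of_nonneg_left h1' hκ0, mul_le_mul_of_nonneg_left h2 ha0.le,
      mul_nonneg (mul_nonneg hκ0 (sub_nonneg.2 h)) (mul_nonneg ha0.le (sq_nonneg c))]
  · right
    have hq : 0 ≤ t ^ 2 * w * c ^ 2 / 4 := by positivity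
    have hA : K ≤ t * c * (1 + a) - t ^ 2 * w * c ^ 2 / 4 * (a * (1 + a) ^ 2) := by
      nlinarith [mul_le_mul_of_nonneg_left h1' (sq_nonneg t)]
    have hρ' : ρ * (c * (1 + κ)) ^ 2 ≤ κ * w * (c * (1 + κ)) ^ 2 :=
      mul_le_mul_of_nonneg_right hρ (sq_nonneg _)
    have hB : K ≤ t * c * (1 + κ) - t ^ 2 * w * c ^ 2 / 4 * (κ * (1 + κ) ^ 2) := by
      rw [mul_assoc 2 t c] at hK'
      generalize t ^ 2 * w * c ^ 2 = q at *
      generalize t * c = r at *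
      refine le_of_mul_le_mul_left ?_ (sub_pos.2 ha1)
      have h3 : 0 ≤ (1 - κ) * (κ - a) * (1 - a) * (κ + a + 3) := by
        refine mul_nonneg (mul_nonneg (mul_nonneg ?_ ?_) ?_) ?_ <;> linarith
      nlinarith [mul_le_mul_of_nonneg_left hA (sub_nonneg.2 hκ1),
        mul_le_mul_of_nonneg_left hK' (sub_nonneg.2 h.le), mul_nonneg hq h3]
    nlinarith [mul_le_mul_of_nonneg_left hρ' (sq_nonneg t)]

lemma IsCentered.prodProb_largeDeviation_le_of_points (h : IsCentered P X) (hL : Real.log 2 ≤ L)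
    (hu : n * ∑ y, P y * X y ^ 2 = u * L) {κ ρ w c t ε K s₁ zm zp tm tp rm rp : ℝ}
    (hκ0 : 0 ≤ κ) (hκ1 : κ ≤ 1) (hρ0 : 0 ≤ ρ) (hρ : ρ ≤ κ * w) (hc : 0 < c) (ht : 0 ≤ t)
    (hε : 0 ≤ ε) (hK : 1 + ε + t ^ 3 * u / 3 ≤ K)
    (hleft : (∃ s₀, c * (1 + κ) ≤ s₀ ∧ (s₀ - c * (1 + κ)) ^ 2 + ρ * s₀ ^ 2 ≤ 2 * zm ∧
      K ≤ t * s₀ - t ^ 2 * zm / 2) ∨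
      K ≤ t * (c * (1 + κ)) - t ^ 2 * (ρ * (c * (1 + κ)) ^ 2) / 4)
    (h0 : (s₁ - c) ^ 2 ≤ 2 * zp) (h1 : (s₁ - 2 * c) ^ 2 + w * s₁ ^ 2 ≤ 2 * zp)
    (hK₁ : K ≤ t * s₁ - t ^ 2 * zp / 2)
    (htm : 0 ≤ tm) (hrm : 0 ≤ rm) (hzm : 1 + rm ≤ u * (1 - Real.exp (-tm)) - tm * zm)
    (htp : 0 ≤ tp) (hrp : 0 ≤ rp) (hzp : 1 + rp ≤ tp * zp - u * (Real.exp tp - 1))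
    (hsum : Real.exp (-(Real.log 2 * ε)) + Real.exp (-(Real.log 2 * rm)) +
      Real.exp (-(Real.log 2 * rp)) ≤ 1) :
    prodProb P (LargeDeviation X L (c * (1 + κ)) ρ (n := n)) ≤ Real.exp (-L) :=
  h.prodProb_largeDeviation_le hL hu ht hε
    (fun _ _ hs hz hz1 hz2 => hK.trans (tilt_ge ht (by positivity) hρ0
      (sq_sub_add_le hκ0 hκ1 hρ h0 h1) hK₁ hleft hs hz hz1 hz2))
    (h.prodProb_sum_sq_lt_le hL hu htm hrm hzm) (h.prodProb_lt_sum_sq_le hL hu htp hrp hzp) hsum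

lemma exp_neg_log_two_mul_le {r q : ℝ} (hr : 0 ≤ r)
    (hq : 1 ≤ q * ∑ k ∈ Finset.range 12, (0.6931471803 * r) ^ k / (k.factorial : ℝ)) :
    Real.exp (-(Real.log 2 * r)) ≤ q := by
  have h0 : 0 ≤ 0.6931471803 * r := by positivity
  have h1 := Real.sum_le_exp_of_nonneg h0 12
  have h2 : 0.6931471803 * r ≤ Real.log 2 * r :=
    mul_le_mul_of_nonneg_right Real.log_two_gt_d9.le hr
  have h3 : 0 < ∑ k ∈ Finset.range 12, (0.6931471803 * r) ^ k / (k.factorial : ℝ) := by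
    rw [Finset.sum_range_succ']
    have : 0 ≤ ∑ k ∈ Finset.range 11,
        (0.6931471803 * r) ^ (k + 1) / ((k + 1).factorial : ℝ) :=
      Finset.sum_nonneg fun k _ => by positivity
    norm_num
    linarith
  have hq0 : 0 < q := pos_of_mul_pos_left (one_pos.trans_le hq) h3.le
  rw [Real.exp_neg]
  refine inv_le_of_inv_le₀ hq0 ?_
  rw [inv_le_iff_one_le_mul₀ hq0, mul_comm]
  exact hq.trans (mul_le_mul_of_nonneg_left (h1.trans (Real.exp_le_exp.2 h2)) hq0.le)

lemma exp_neg_nat_le (k : ℕ) : Real.exp (-(k : ℝ)) ≤ (1 / 2.7182818283) ^ k := by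
  rw [Real.exp_neg, ← Real.exp_one_pow, one_div, inv_pow]
  have := Real.exp_one_gt_d9
  gcongr

/-- The bound for `u` in an interval `[u₀, u₁]`, reduced to numerical conditions. -/
lemma IsCentered.prodProb_largeDeviation_le_of_mem_Icc (h : IsCentered P X)
    (hL : Real.log 2 ≤ L) (hu : n * ∑ y, P y * X y ^ 2 = u * L) {κ ρ : ℝ}
    (hκ0 : 0 ≤ κ) (hκ1 : κ ≤ 1) (hρ0 : 0 ≤ ρ) (hρ : ρ * u ≤ 2 * κ)
    (u₀ u₁ t s₀ s₁ ε zm zp rm rp qε qm qp : ℝ) (k : ℕ) (hu₀ : u₀ ≤ u) (hu₁ : u ≤ u₁)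
    (hu₀0 : 0 < u₀) (ht : 0 ≤ t) (hε : 0 ≤ ε)
    (hs₀ : 7 / 3 < s₀ ∧ s₀ < 2 * (7 / 3) ∧ 2 / u₀ * (s₀ - 7 / 3) * s₀ ^ 2 ≤ 2 * (7 / 3) * zm ∧
        1 + ε + t ^ 3 * u₁ / 3 + t ^ 2 * (2 / u₀) * (7 / 3) ^ 2 ≤ 2 * t * (7 / 3) ∨
      2 * (7 / 3) ≤ s₀ ∧ (s₀ - 2 * (7 / 3)) ^ 2 + 2 / u₀ * s₀ ^ 2 ≤ 2 * zm)
    (hs₀' : (s₀ - 7 / 3) ^ 2 ≤ 2 * zm)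
    (hK₀ : 1 + ε + t ^ 3 * u₁ / 3 ≤ t * s₀ - t ^ 2 * zm / 2)
    (hs₁ : (s₁ - 7 / 3) ^ 2 ≤ 2 * zp) (hs₁' : (s₁ - 2 * (7 / 3)) ^ 2 + 2 / u₀ * s₁ ^ 2 ≤ 2 * zp)
    (hK₁ : 1 + ε + t ^ 3 * u₁ / 3 ≤ t * s₁ - t ^ 2 * zp / 2)
    (hrm : 0 ≤ rm) (hzm : 1 + rm ≤ u₀ * (1 - (1 / 2.7182818283) ^ k) - k * zm)
    (hrp : 0 ≤ rp) (hzp : 1 + rp ≤ zp - u₁ * (2.7182818286 - 1))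
    (hqε : 1 ≤ qε * ∑ k ∈ Finset.range 12, (0.6931471803 * ε) ^ k / (k.factorial : ℝ))
    (hqm : 1 ≤ qm * ∑ k ∈ Finset.range 12, (0.6931471803 * rm) ^ k / (k.factorial : ℝ))
    (hqp : 1 ≤ qp * ∑ k ∈ Finset.range 12, (0.6931471803 * rp) ^ k / (k.factorial : ℝ))
    (hq : qε + qm + qp ≤ 1) :
    prodProb P (LargeDeviation X L (7 / 3 * (1 + κ)) ρ (n := n)) ≤ Real.exp (-L) := by
  have hρ' : ρ ≤ κ * (2 / u₀) := by
    rw [mul_div_assoc', le_div_iff₀ hu₀0]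
    nlinarith [mul_le_mul_of_nonneg_left hu₀ hρ0]
  have hm := exp_neg_nat_le k
  have hm0 : Real.exp (-(k : ℝ)) ≤ 1 := Real.exp_le_one_iff.2 (by simp)
  refine h.prodProb_largeDeviation_le_of_points (t := t) (ε := ε) (K := 1 + ε + t ^ 3 * u₁ / 3)
    (zm := zm) (tm := k) (tp := 1) hL hu hκ0 hκ1 hρ0 hρ' (by norm_num) ht hε (by gcongr) ?_
    hs₁ hs₁' hK₁ (by positivity) hrm ?_ zero_le_one hrp ?_ ?_
  · rcases hs₀ with ⟨h1, h2, h3, h4⟩ | ⟨h1, h2⟩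
    · exact exists_left_point hκ0 hκ1 hρ' (by positivity) (by norm_num) h1 h2 hs₀' h3 hK₀ h4
    · exact Or.inl ⟨s₀, by linarith, sq_sub_add_le hκ0 hκ1 hρ' hs₀' h2, hK₀⟩
  · refine hzm.trans (sub_le_sub_right ?_ _)
    calc u₀ * (1 - (1 / 2.7182818283) ^ k) ≤ u₀ * (1 - Real.exp (-k)) := by gcongr
      _ ≤ u * (1 - Real.exp (-k)) := by gcongr
  · have := Real.exp_one_lt_d9
    nlinarith [Real.exp_one_gt_d9]
  · linarith [exp_neg_log_two_mul_le hε hqε, exp_neg_log_two_mul_le hrm hqm,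
      exp_neg_log_two_mul_le hrp hqp]

lemma IsCentered.prodProb_largeDeviation_le_of_le_twentyFour (h : IsCentered P X)
    (hL : Real.log 2 ≤ L) (hu : n * ∑ y, P y * X y ^ 2 = u * L) {κ ρ : ℝ}
    (hκ0 : 0 ≤ κ) (hκ1 : κ ≤ 1) (hρ0 : 0 ≤ ρ) (hρ : ρ * u ≤ 2 * κ)
    (hu₀ : 5.2 ≤ u) (hu₁ : u ≤ 24) :
    prodProb P (LargeDeviation X L (7 / 3 * (1 + κ)) ρ (n := n)) ≤ Real.exp (-L) := by
  rcases le_total u 5.5 with h1 | h1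
  · refine h.prodProb_largeDeviation_le_of_mem_Icc hL hu hκ0 hκ1 hρ0 hρ 5.2 5.5 0.61 2.81 7.7 0.24
      0.311 16.343 3.008 5.892 0.8468 0.1244 0.0169 3 hu₀ h1 ?_ ?_ ?_ (Or.inl ?_) ?_ ?_ ?_ ?_ ?_ ?_
      ?_ ?_ ?_ ?_ ?_ ?_ ?_ <;> norm_num [Finset.sum_range_succ, Nat.factorial]
  rcases le_total u 6.2 with h2 | h2
  · refine h.prodProb_largeDeviation_le_of_mem_Icc hL hu hκ0 hκ1 hρ0 hρ 5.5 6.2 0.58 2.91 8.2 0.22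
      0.383 18.625 3.077 6.971 0.8586 0.1186 0.0081 3 h1 h2 ?_ ?_ ?_ (Or.inl ?_) ?_ ?_ ?_ ?_ ?_ ?_
      ?_ ?_ ?_ ?_ ?_ ?_ ?_ <;> norm_num [Finset.sum_range_succ, Nat.factorial]
  rcases le_total u 8 with h3 | h3
  · refine h.prodProb_largeDeviation_le_of_mem_Icc hL hu hκ0 hκ1 hρ0 hρ 6.2 8 0.53 3.22 8.9 0.22
      0.637 22.071 3.086 7.324 0.8586 0.1178 0.0063 2 h2 h3 ?_ ?_ ?_ (Or.inl ?_) ?_ ?_ ?_ ?_ ?_ ?_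
      ?_ ?_ ?_ ?_ ?_ ?_ ?_ <;> norm_num [Finset.sum_range_succ, Nat.factorial]
  rcases le_total u 14 with h4 | h4
  · refine h.prodProb_largeDeviation_le_of_mem_Icc hL hu hκ0 hκ1 hρ0 hρ 8 14 0.42 3.8 10.4 0.15
      1.136 32.565 3.645 7.509 0.9013 0.08 0.0056 2 h3 h4 ?_ ?_ ?_ (Or.inl ?_) ?_ ?_ ?_ ?_ ?_ ?_
      ?_ ?_ ?_ ?_ ?_ ?_ ?_ <;> norm_num [Finset.sum_range_succ, Nat.factorial]
  · refine h.prodProb_largeDeviation_le_of_mem_Icc hL hu hκ0 hκ1 hρ0 hρ 14 24 0.32 5.03 12.1 0.16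
      3.661 47.848 4.188 5.609 0.8951 0.0549 0.0206 1 h4 hu₁ ?_ ?_ ?_ (Or.inr ?_) ?_ ?_ ?_ ?_ ?_ ?_
      ?_ ?_ ?_ ?_ ?_ ?_ ?_ <;> norm_num [Finset.sum_range_succ, Nat.factorial]

lemma exp_neg_log_two_sum_le_one {x : ℝ} (hx0 : 0 < x) (hx1 : x ≤ 0.578) :
    Real.exp (-(Real.log 2 * (x / 3))) + Real.exp (-(Real.log 2 * (4 / x - 1))) +
      Real.exp (-(Real.log 2 * (3 / x - 1))) ≤ 1 := by
  have hl := Real.log_two_gt_d9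
  have he := Real.exp_one_gt_d9
  have hexp : ∀ (k : ℕ) (v : ℝ), (2.718 : ℝ) ^ k * (v - k + 1) ≤ Real.exp v ∨ v - k + 1 < 0 := by
    intro k v
    rcases le_or_gt 0 (v - k + 1) with hv | hv
    · left
      calc (2.718 : ℝ) ^ k * (v - k + 1) ≤ Real.exp 1 ^ k * Real.exp (v - k) := by
            gcongr
            · linarith
            · exact Real.add_one_le_exp _
        _ = Real.exp v := by rw [Real.exp_one_pow, ← Real.exp_add]; congr 1; ring
    · exact Or.inr hv
  have hinv : ∀ v q : ℝ, 0 < q → 1 ≤ q * Real.exp v → Real.exp (-v) ≤ q := by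
    intro v q hq h
    rw [Real.exp_neg]
    exact inv_le_of_inv_le₀ hq (by rwa [inv_le_iff_one_le_mul₀ hq, mul_comm])
  have hx : x * (1 / x) = 1 := by field_simp
  have hix : 1.73 ≤ 1 / x := by rw [le_div_iff₀ hx0]; linarith
  have h1 : Real.exp (-(Real.log 2 * (x / 3))) ≤ 1 - 0.2 * x := by
    refine hinv _ _ (by linarith) ?_
    have h3 : 1 ≤ (1 - 0.2 * x) * (1 + 0.231 * x + 0.0266 * x ^ 2) := by nlinarith
    have h4 : 1 + 0.231 * x + 0.0266 * x ^ 2 ≤ Real.exp (Real.log 2 * (x / 3)) := by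
      have h5 := Real.quadratic_le_exp_of_nonneg (show 0 ≤ Real.log 2 * (x / 3) by positivity)
      have h6 : 0.231 * x ≤ Real.log 2 * (x / 3) := by nlinarith
      nlinarith
    nlinarith
  have h2 : Real.exp (-(Real.log 2 * (4 / x - 1))) ≤ x / 30 := by
    refine hinv _ _ (by positivity) ?_
    have h3 : 0.693 * (4 * (1 / x) - 1) ≤ Real.log 2 * (4 / x - 1) := by
      rw [← mul_one_div 4 x]
      nlinarith
    rcases hexp 4 (Real.log 2 * (4 / x - 1)) with h | h
    · norm_num at h
      nlinarith
    · push_cast at h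
      linarith
  have h3 : Real.exp (-(Real.log 2 * (3 / x - 1))) ≤ x / 10 := by
    refine hinv _ _ (by positivity) ?_
    have h3 : 0.693 * (3 * (1 / x) - 1) ≤ Real.log 2 * (3 / x - 1) := by
      rw [← mul_one_div 3 x]
      nlinarith
    rcases hexp 3 (Real.log 2 * (3 / x - 1)) with h | h
    · norm_num at h
      nlinarith
    · push_cast at h
      linarith
  linarith

lemma exp_neg_le_one_sub_add {x : ℝ} (hx : 0 ≤ x) : Real.exp (-x) ≤ 1 - x + x ^ 2 / 2 := by
  have h1 := Real.quadratic_le_exp_of_nonneg hx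
  have h2 : Real.exp (-x) * Real.exp x = 1 := by rw [← Real.exp_add]; simp
  have h3 : 0 < Real.exp x := Real.exp_pos x
  refine le_of_mul_le_mul_right ?_ h3
  rw [h2]
  have h4 : 0 ≤ 1 - x + x ^ 2 / 2 := by nlinarith [sq_nonneg (x - 1)]
  nlinarith [mul_le_mul_of_nonneg_left h1 h4, sq_nonneg (x ^ 2)]

lemma exp_le_cubic {x : ℝ} (h0 : 0 ≤ x) (h1 : x ≤ 1) :
    Real.exp x ≤ 1 + x + x ^ 2 / 2 + 2 / 9 * x ^ 3 := by
  have := Real.exp_bound' h0 h1 (n := 3) (by norm_num)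
  norm_num [Finset.sum_range_succ, Nat.factorial] at this
  linarith

lemma IsCentered.prodProb_largeDeviation_le_of_twentyFour_le (h : IsCentered P X)
    (hL : Real.log 2 ≤ L) (hu : n * ∑ y, P y * X y ^ 2 = u * L) {κ ρ : ℝ}
    (hκ0 : 0 ≤ κ) (hκ1 : κ ≤ 1) (hρ0 : 0 ≤ ρ) (hρ : ρ * u ≤ 2 * κ) (hu₀ : 24 ≤ u) :
    prodProb P (LargeDeviation X L (7 / 3 * (1 + κ)) ρ (n := n)) ≤ Real.exp (-L) := by
  obtain ⟨e, he0, he⟩ : ∃ e : ℝ, 0 < e ∧ u * e ^ 4 = 8 := by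
    refine ⟨√√(8 / u), by positivity, ?_⟩
    rw [show √√(8 / u) ^ 4 = (√√(8 / u) ^ 2) ^ 2 by ring, Real.sq_sqrt (by positivity),
      Real.sq_sqrt (by positivity)]
    field_simp
  have hx : e ^ 2 ≤ 0.5775 := by
    by_contra! hcon
    nlinarith [sq_nonneg (e ^ 2)]
  have he1 : e ≤ 0.76 := by nlinarith
  have hu' : u = 8 / e ^ 4 := by rw [eq_div_iff (by positivity), he]
  have hρ' : ρ ≤ κ * (e ^ 4 / 4) := by nlinarith [pow_pos he0 4]
  have hsc : ∀ p c w b : ℝ, (p - c * e ^ 2) ^ 2 + w * p ^ 2 ≤ 16 * b →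
      (p / e ^ 2 - c) ^ 2 + w * (p / e ^ 2) ^ 2 ≤ 2 * (u * b) := by
    intro p c w b hp
    have h1 : p / e ^ 2 * e ^ 2 = p := by field_simp
    refine le_of_mul_le_mul_right ?_ (pow_pos he0 4)
    calc ((p / e ^ 2 - c) ^ 2 + w * (p / e ^ 2) ^ 2) * e ^ 4
        = (p / e ^ 2 * e ^ 2 - c * e ^ 2) ^ 2 + w * (p / e ^ 2 * e ^ 2) ^ 2 := by ring
      _ ≤ 16 * b := by rwa [h1]
      _ = 2 * (u * b) * e ^ 4 := by linear_combination -2 * b * he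
  have hue2 : u * e ^ 2 = 8 / e ^ 2 := by rw [hu']; field_simp
  have hpow : ∀ k, 0 < e ^ k := pow_pos he0
  have hK : ∀ p b : ℝ, p = 2 * (2 + b + 2 * e ^ 2 / 3) →
      1 + 2 * e ^ 2 / 3 ≤ e ^ 2 / 2 * (p / e ^ 2) - (e ^ 2 / 2) ^ 2 * (u * (1 + b)) / 2 := by
    intro p b hp
    have h1 : e ^ 2 / 2 * (p / e ^ 2) = p / 2 := by field_simp
    have h2 : (e ^ 2 / 2) ^ 2 * (u * (1 + b)) / 2 = 1 + b := by
      linear_combination (1 + b) / 8 * he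
    rw [h1, h2, hp]
    linarith
  refine h.prodProb_largeDeviation_le_of_points (t := e ^ 2 / 2) (ε := e ^ 2 / 3)
    (K := 1 + 2 * e ^ 2 / 3) (zm := u * (1 - e)) (zp := u * (1 + e)) (tm := e) (tp := 3 * e / 4)
    (rm := 4 / e ^ 2 - 1) (rp := 3 / e ^ 2 - 1) (s₁ := 2 * (2 + e + 2 * e ^ 2 / 3) / e ^ 2)
    hL hu hκ0 hκ1 hρ0 hρ' (by norm_num) (by positivity) (by positivity) ?_ ?_ ?_ ?_ ?_ he0.le
    ?_ ?_ (by positivity) ?_ ?_ ?_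
  · nlinarith
  · refine Or.inl ⟨2 * (2 - e + 2 * e ^ 2 / 3) / e ^ 2, ?_,
      sq_sub_add_le hκ0 hκ1 hρ' ?_ ?_, ?_⟩
    · rw [le_div_iff₀ (hpow 2)]
      nlinarith
    · have := hsc (2 * (2 - e + 2 * e ^ 2 / 3)) (7 / 3) 0 (1 - e)
        (by nlinarith [hpow 2, hpow 3, hpow 4, mul_nonneg (hpow 2).le (sub_nonneg.2 he1),
          mul_nonneg (hpow 3).le (sub_nonneg.2 he1)])
      simpa using this
    · refine hsc _ _ _ _ ?_
      have h1 : (2 * (2 - e + 2 * e ^ 2 / 3)) ^ 2 ≤ 16 := by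
        have : 0 ≤ 2 * (2 - e + 2 * e ^ 2 / 3) := by nlinarith
        nlinarith
      have h2 : 0 ≤ e ^ 2 * (68 / 3 - 40 / 3 * e - 136 / 9 * e ^ 2) :=
        mul_nonneg (hpow 2).le (by linarith)
      nlinarith [mul_le_mul_of_nonneg_left h1 (hpow 4).le]
    · exact hK _ (-e) (by ring)
  · have := hsc (2 * (2 + e + 2 * e ^ 2 / 3)) (7 / 3) 0 (1 + e)
        (by nlinarith [hpow 2, hpow 3, hpow 4, mul_nonneg (hpow 2).le (sub_nonneg.2 he1),
          mul_nonneg (hpow 3).le (sub_nonneg.2 he1)])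
    simpa using this
  · refine hsc _ _ _ _ ?_
    have h1 : (2 * (2 + e + 2 * e ^ 2 / 3)) ^ 2 ≤ 40 := by
      have : 0 ≤ 2 * (2 + e + 2 * e ^ 2 / 3) := by positivity
      nlinarith
    have h2 : 0 ≤ e ^ 2 * (68 / 3 + 40 / 3 * e - 190 / 9 * e ^ 2) :=
      mul_nonneg (hpow 2).le (by linarith)
    nlinarith [mul_le_mul_of_nonneg_left h1 (hpow 4).le]
  · exact hK _ e rfl
  · rw [sub_nonneg, le_div_iff₀ (hpow 2)]
    linarith
  · have h1 := mul_le_mul_of_nonneg_left (exp_neg_le_one_sub_add he0.le) (by linarith : 0 ≤ u)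
    have h2 : 4 / e ^ 2 = u * e ^ 2 / 2 := by rw [hue2]; ring
    linarith
  · rw [sub_nonneg, le_div_iff₀ (hpow 2)]
    linarith
  · have h1 := mul_le_mul_of_nonneg_left
      (exp_le_cubic (x := 3 * e / 4) (by positivity) (by linarith)) (by linarith : 0 ≤ u)
    have h2 : 3 / e ^ 2 = 3 / 8 * (u * e ^ 2) := by rw [hue2]; ring
    have h3 : u * e ^ 2 * e ≤ u * e ^ 2 * 0.76 := by gcongr
    nlinarith [mul_pos (show 0 < u by linarith) (hpow 2)]
  · exact exp_neg_log_two_sum_le_one (hpow 2) (by linarith)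

lemma IsCentered.prodProb_largeDeviation_le_of_le (h : IsCentered P X) (hL : Real.log 2 ≤ L)
    (hu : n * ∑ y, P y * X y ^ 2 = u * L) {κ ρ : ℝ} (hκ0 : 0 ≤ κ)
    (hu₁ : u ≤ 49 / 36 * (1 + κ) ^ 2) :
    prodProb P (LargeDeviation X L (7 / 3 * (1 + κ)) ρ (n := n)) ≤ Real.exp (-L) := by
  have hL0 : 0 < L := (Real.log_pos one_lt_two).trans_le hL
  have hk : 0 < 1 + κ := by linarith
  have ht : 6 / 7 / (1 + κ) * (1 + κ) = 6 / 7 := by field_simp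
  have ht0 : 0 < 6 / 7 / (1 + κ) := by positivity
  have ht1 : 6 / 7 / (1 + κ) ≤ 1 := by rw [div_le_one hk]; linarith
  generalize 6 / 7 / (1 + κ) = t at *
  refine prodProb_le_exp h.nonneg _ (sum_mul_exp_mul_le h.nonneg h.sum_eq_one h.abs_le_one
    h.mean_eq_zero ht0.le ht1) fun ω hω => ?_
  have hs := hω.1
  rw [le_div_iff₀ hL0] at hs
  rw [← Finset.mul_sum, mul_left_comm, hu]
  have h1 : t ^ 2 * u ≤ 1 := by
    calc t ^ 2 * u ≤ t ^ 2 * (49 / 36 * (1 + κ) ^ 2) := by gcongr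
      _ = 49 / 36 * (t * (1 + κ)) ^ 2 := by ring
      _ = 1 := by rw [ht]; norm_num
  have h2 : t * (7 / 3 * (1 + κ) * L) = 2 * L := by linear_combination 7 / 3 * L * ht
  nlinarith [mul_le_mul_of_nonneg_left hs ht0.le, mul_le_mul_of_nonneg_right h1 hL0.le]

lemma IsCentered.prodProb_largeDeviation_le_of_lt (h : IsCentered P X) (hL : Real.log 2 ≤ L)
    (hu : n * ∑ y, P y * X y ^ 2 = u * L) {κ ρ : ℝ} (hκ0 : 0 ≤ κ) (hκ1 : κ ≤ 1) (hρ0 : 0 ≤ ρ)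
    (hρ : ρ * u ≤ 2 * κ) (hu₀ : 49 / 36 * (1 + κ) ^ 2 < u) (hu₁ : u ≤ 5.2) :
    prodProb P (LargeDeviation X L (7 / 3 * (1 + κ)) ρ (n := n)) ≤ Real.exp (-L) := by
  have hL0 : 0 < L := (Real.log_pos one_lt_two).trans_le hL
  have hρ1 : ρ * (1 + κ) ^ 2 ≤ 72 / 49 * κ := by
    nlinarith [mul_le_mul_of_nonneg_left hu₀.le hρ0]
  have hρ2 : ρ ≤ 72 / 49 * (0.1133 + 0.2272 * κ) := by
    refine le_of_mul_le_mul_right ?_ (show 0 < (1 + κ) ^ 2 by positivity)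
    nlinarith [mul_nonneg hκ0 (sq_nonneg (κ - 0.39)), sq_nonneg (κ - 0.39)]
  have he := Real.exp_one_lt_d9
  have hm : prodProb P (fun ω : Fin n → S => (∑ i, X (ω i) ^ 2) / L < 0) ≤
      Real.exp (-L) * 0 := by
    rw [mul_zero]
    refine Finset.sum_nonpos fun ω _ => ?_
    rw [if_neg (not_lt.2 (by positivity))]
  refine h.prodProb_largeDeviation_le hL hu (t := 0.6) (ε := 0.0246) (zm := 0) (zp := 16.22)
    (by norm_num) (by norm_num) (fun s z hs hz hz1 hz2 => ?_) hm
    (h.prodProb_lt_sum_sq_le hL hu (t := 1) (r := 6.28) zero_le_one (by norm_num) (by nlinarith)) ?_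
  · refine (show (_ : ℝ) ≤ 1.399 by linarith).trans (tilt_ge (s₁ := 7.2) (by norm_num)
      (by positivity) hρ0 ?_ (by norm_num) (Or.inr ?_) hs hz hz1 hz2)
    · nlinarith
    · nlinarith
  · have h1 := exp_neg_log_two_mul_le (r := 0.0246) (q := 0.9835) (by norm_num)
      (by norm_num [Finset.sum_range_succ, Nat.factorial])
    have h2 := exp_neg_log_two_mul_le (r := 6.28) (q := 0.0135) (by norm_num)
      (by norm_num [Finset.sum_range_succ, Nat.factorial])
    linarith

/-- The one-sided deviation bound, uniformly in the variance proxy `u`. -/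
lemma IsCentered.prodProb_largeDeviation_le_exp (h : IsCentered P X) (hL : Real.log 2 ≤ L)
    (hu : n * ∑ y, P y * X y ^ 2 = u * L) {κ ρ : ℝ} (hκ0 : 0 ≤ κ) (hκ1 : κ ≤ 1) (hρ0 : 0 ≤ ρ)
    (hρ : ρ * u ≤ 2 * κ) :
    prodProb P (LargeDeviation X L (7 / 3 * (1 + κ)) ρ (n := n)) ≤ Real.exp (-L) := by
  rcases le_or_gt u (49 / 36 * (1 + κ) ^ 2) with h1 | h1
  · exact h.prodProb_largeDeviation_le_of_le hL hu hκ0 h1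
  rcases le_total u 5.2 with h2 | h2
  · exact h.prodProb_largeDeviation_le_of_lt hL hu hκ0 hκ1 hρ0 hρ h1 h2
  rcases le_total u 24 with h3 | h3
  · exact h.prodProb_largeDeviation_le_of_le_twentyFour hL hu hκ0 hκ1 hρ0 hρ h2 h3
  · exact h.prodProb_largeDeviation_le_of_twentyFour_le hL hu hκ0 hκ1 hρ0 hρ h3

end Deviation

section EmpiricalVariance

lemma sum_sub_sq_div_sub_sq {S : Type*} {n : ℕ} (hn : 0 < n) (f : S → ℝ) (m : ℝ) (ω : Fin n → S) :
    (∑ i, (f (ω i) - m) ^ 2) / n - ((∑ i, (f (ω i) - m)) / n) ^ 2 =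
      (∑ i, f (ω i) ^ 2) / n - ((∑ i, f (ω i)) / n) ^ 2 := by
  have hn' : (n : ℝ) ≠ 0 := by positivity
  have h1 : ∑ i, (f (ω i) - m) ^ 2 = ∑ i, f (ω i) ^ 2 - 2 * m * ∑ i, f (ω i) + n * m ^ 2 := by
    simp_rw [sub_sq]
    rw [Finset.sum_add_distrib, Finset.sum_sub_distrib, Finset.mul_sum]
    simp only [Finset.sum_const, Finset.card_univ, Fintype.card_fin, nsmul_eq_mul]
    congr 2
    exact Finset.sum_congr rfl fun i _ => by ring
  have h2 : ∑ i, (f (ω i) - m) = ∑ i, f (ω i) - n * m := by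
    rw [Finset.sum_sub_distrib]; simp
  rw [h1, h2]
  field_simp
  ring

variable {S : Type*} [Fintype S] {P : S → ℝ} {n : ℕ}

lemma sum_card_div_mul [DecidableEq S] (ω : Fin n → S) (g : S → ℝ) :
    ∑ y, ((Finset.univ.filter (fun i => ω i = y)).card : ℝ) / n * g y =
      (∑ i, g (ω i)) / n := by
  have h : ∀ y, ((Finset.univ.filter (fun i => ω i = y)).card : ℝ) / n * g y =
      ∑ i, if ω i = y then g y / n else 0 := by
    intro y
    rw [← Finset.sum_filter, Finset.sum_const, nsmul_eq_mul]
    ring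
  simp_rw [h]
  rw [Finset.sum_comm, Finset.sum_div]
  simp

/-- One-sided empirical Bernstein bound for a centered function `g` bounded by `M`. -/
lemma prodProb_mean_gt_le (hP0 : ∀ y, 0 ≤ P y) (hP1 : ∑ y, P y = 1) (hn : 0 < n) {g : S → ℝ}
    {H M L : ℝ} (hL : Real.log 2 ≤ L) (hM : 0 < M) (hMH : M ≤ H) (hHM : H ≤ 2 * M)
    (hg : ∀ y, |g y| ≤ M) (hg0 : ∑ y, P y * g y = 0)
    (hg2 : ∑ y, P y * g y ^ 2 ≤ M * (H - M)) :
    prodProb P (fun ω : Fin n → S =>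
      √(2 * ((∑ i, g (ω i) ^ 2) / n - ((∑ i, g (ω i)) / n) ^ 2) * L / n)
        + 7 * H * L / (3 * n) < (∑ i, g (ω i)) / n) ≤ Real.exp (-L) := by
  have hL0 : 0 < L := (Real.log_pos one_lt_two).trans_le hL
  have hn' : (0 : ℝ) < n := by exact_mod_cast hn
  have hX2 : ∑ y, P y * (g y / M) ^ 2 = (∑ y, P y * g y ^ 2) / M ^ 2 := by
    rw [Finset.sum_div]
    exact Finset.sum_congr rfl fun y _ => by rw [div_pow, mul_div_assoc]
  have hX : IsCentered P (fun y => g y / M) := by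
    refine ⟨hP0, hP1, fun y => ?_, ?_⟩
    · rw [abs_div, abs_of_pos hM, div_le_one hM]
      exact hg y
    · simp_rw [mul_div_assoc', ← Finset.sum_div, hg0, zero_div]
  have hκ0 : 0 ≤ H / M - 1 := by rw [sub_nonneg, one_le_div hM]; exact hMH
  have hκ1 : H / M - 1 ≤ 1 := by
    have : H / M ≤ 2 := by rwa [div_le_iff₀ hM]
    linarith
  refine le_trans (prodProb_mono hP0 fun ω hω => ?_) (hX.prodProb_largeDeviation_le_exp (n := n) hL
    (u := n * (∑ y, P y * (g y / M) ^ 2) / L) (by field_simp) hκ0 hκ1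
    (ρ := 2 * L / n) (by positivity) ?_)
  · have h0 := Real.sqrt_nonneg
      (2 * ((∑ i, g (ω i) ^ 2) / n - ((∑ i, g (ω i)) / n) ^ 2) * L / n)
    have hsq : √(2 * ((∑ i, g (ω i) ^ 2) / n - ((∑ i, g (ω i)) / n) ^ 2) * L / n) <
        (∑ i, g (ω i)) / n - 7 * H * L / (3 * n) := by linarith
    rw [Real.sqrt_lt' (h0.trans_lt hsq)] at hsq
    have h1 : (∑ i, g (ω i) / M) = (∑ i, g (ω i)) / M := by rw [Finset.sum_div]
    have h2 : (∑ i, (g (ω i) / M) ^ 2) = (∑ i, g (ω i) ^ 2) / M ^ 2 := by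
      simp_rw [div_pow, Finset.sum_div]
    have h3 : 7 * H * L / (3 * n) ≤ (∑ i, g (ω i)) / n := by linarith
    refine ⟨?_, ?_⟩
    · rw [h1]
      have h4 : 7 * H * L / 3 ≤ ∑ i, g (ω i) := by
        rw [div_le_div_iff₀ (by positivity) hn'] at h3
        refine le_of_mul_le_mul_right ?_ (show (0 : ℝ) < 3 * n by positivity)
        linarith
      rw [div_div, le_div_iff₀ (by positivity)]
      calc 7 / 3 * (1 + (H / M - 1)) * (M * L) = 7 * H * L / 3 := by field_simp; ring
        _ ≤ _ := h4
    · rw [h1, h2]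
      have h4 := mul_le_mul_of_nonneg_left hsq.le
        (show 0 ≤ (n : ℝ) ^ 2 / (M ^ 2 * L ^ 2) by positivity)
      generalize ∑ i, g (ω i) ^ 2 = q at *
      generalize ∑ i, g (ω i) = s at *
      have e1 : (n : ℝ) ^ 2 / (M ^ 2 * L ^ 2) * (2 * (q / n - (s / n) ^ 2) * L / n) =
          2 * (q / M ^ 2 / L) - 2 * L / n * (s / M / L) ^ 2 := by
        field_simp
      have e2 : (n : ℝ) ^ 2 / (M ^ 2 * L ^ 2) * (s / n - 7 * H * L / (3 * n)) ^ 2 =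
          (s / M / L - 7 / 3 * (1 + (H / M - 1))) ^ 2 := by
        field_simp
        ring
      linarith
  · rw [hX2]
    have h1 : 2 * L / n * (n * ((∑ y, P y * g y ^ 2) / M ^ 2) / L) =
        2 * ((∑ y, P y * g y ^ 2) / M ^ 2) := by field_simp
    have h2 : (∑ y, P y * g y ^ 2) / M ^ 2 ≤ H / M - 1 := by
      rw [div_le_iff₀ (by positivity)]
      calc _ ≤ M * (H - M) := hg2
        _ = (H / M - 1) * M ^ 2 := by field_simp
    rw [h1]
    linarith

lemma sum_mul_sub_mean_sq_le (hP0 : ∀ y, 0 ≤ P y) (hP1 : ∑ y, P y = 1) {f : S → ℝ} {H : ℝ}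
    (hf0 : ∀ y, 0 ≤ f y) (hfH : ∀ y, f y ≤ H) :
    ∑ y, P y * (f y - ∑ z, P z * f z) ^ 2 ≤
      (∑ z, P z * f z) * (H - ∑ z, P z * f z) := by
  generalize hm : ∑ z, P z * f z = m
  calc ∑ y, P y * (f y - m) ^ 2
      ≤ ∑ y, ((H - 2 * m) * (P y * f y) + m ^ 2 * P y) :=
        Finset.sum_le_sum fun y _ => by
          nlinarith [mul_nonneg (hP0 y) (mul_nonneg (hf0 y) (sub_nonneg.2 (hfH y)))]
    _ = m * (H - m) := by
        rw [Finset.sum_add_distrib, ← Finset.mul_sum, ← Finset.mul_sum, hm, hP1]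
        ring

lemma prodProb_abs_mean_gt_le (hP0 : ∀ y, 0 ≤ P y) (hP1 : ∑ y, P y = 1) (hn : 0 < n) {f : S → ℝ}
    {H L : ℝ} (hL : Real.log 2 ≤ L) (hH : 0 < H) (hf0 : ∀ y, 0 ≤ f y) (hfH : ∀ y, f y ≤ H) :
    prodProb P (fun ω : Fin n → S =>
      √(2 * ((∑ i, f (ω i) ^ 2) / n - ((∑ i, f (ω i)) / n) ^ 2) * L / n)
        + 7 * H * L / (3 * n) < |∑ y, P y * f y - (∑ i, f (ω i)) / n|) ≤ 2 * Real.exp (-L) := by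
  have hn' : (n : ℝ) ≠ 0 := by positivity
  have hvar := sum_mul_sub_mean_sq_le hP0 hP1 hf0 hfH
  have hm0 : 0 ≤ ∑ y, P y * f y := Finset.sum_nonneg fun y _ => mul_nonneg (hP0 y) (hf0 y)
  have hmH : ∑ y, P y * f y ≤ H := by
    calc ∑ y, P y * f y ≤ ∑ y, P y * H :=
          Finset.sum_le_sum fun y _ => mul_le_mul_of_nonneg_left (hfH y) (hP0 y)
      _ = H := by rw [← Finset.sum_mul, hP1, one_mul]
  have hcen : ∑ y, P y * (f y - ∑ z, P z * f z) = 0 := by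
    simp_rw [mul_sub]
    rw [Finset.sum_sub_distrib, ← Finset.sum_mul, hP1, one_mul, sub_self]
  generalize ∑ y, P y * f y = m at *
  obtain ⟨M, hM0, hMH, hHM, hMm, hMHm, hMv⟩ : ∃ M, 0 < M ∧ M ≤ H ∧ H ≤ 2 * M ∧ m ≤ M ∧
      H - m ≤ M ∧ m * (H - m) = M * (H - M) := by
    rcases le_total m (H - m) with h | h
    · exact ⟨H - m, by linarith, by linarith, by linarith, h, le_rfl, by ring⟩
    · exact ⟨m, by linarith, hmH, by linarith, le_rfl, h, rfl⟩
  have hbd : ∀ y, |f y - m| ≤ M := fun y =>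
    abs_le.2 ⟨by linarith [hf0 y], by linarith [hfH y]⟩
  have hsum : ∀ ω : Fin n → S, (∑ i, (f (ω i) - m)) / n = (∑ i, f (ω i)) / n - m := by
    intro ω
    rw [Finset.sum_sub_distrib]
    simp only [Finset.sum_const, Finset.card_univ, Fintype.card_fin, nsmul_eq_mul]
    field_simp
  have h1 := prodProb_mean_gt_le (n := n) hP0 hP1 hn hL hM0 hMH hHM hbd hcen (hMv ▸ hvar)
  have h2 := prodProb_mean_gt_le (n := n) (g := fun y => -(f y - m)) hP0 hP1 hn hL hM0 hMH hHM
    (fun y => by rw [abs_neg]; exact hbd y) (by simp_rw [mul_neg, Finset.sum_neg_distrib, hcen,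
      neg_zero]) (by simpa only [neg_sq] using hMv ▸ hvar)
  simp only [neg_sq, Finset.sum_neg_distrib, neg_div, sum_sub_sq_div_sub_sq hn] at h1 h2
  simp only [hsum] at h1 h2
  refine (prodProb_mono hP0 fun ω hω => ?_).trans
    (((prodProb_or_le hP0 _ _).trans (add_le_add h1 h2)).trans_eq (two_mul _).symm)
  refine (lt_abs.1 hω).symm.imp (fun h => ?_) fun h => ?_
  · rwa [neg_sub] at h
  · rwa [neg_sub]

end EmpiricalVariance

end EmpiricalBernstein

/-- empirical Bernstein inequality (Maurer–Pontil) for a `[0,H]`-valued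
function `f` of i.i.d. samples from a finite distribution `P`. The samples are modeled by
`ω : Fin n → S` with probability weight `∏ i, P (ω i)`; `P̂ y = #{i : ω i = y}/n` is the
empirical distribution and `V̂` the empirical variance of `f` under `P̂`. -/
theorem empirical_bernstein {S : Type*} [Fintype S] [DecidableEq S]
    (P : S → ℝ) (hP0 : ∀ y, 0 ≤ P y) (hP1 : ∑ y, P y = 1)
    (H : ℝ) (f : S → ℝ) (hf0 : ∀ y, 0 ≤ f y) (hfH : ∀ y, f y ≤ H)
    (n : ℕ) (hn : 2 ≤ n) (δ : ℝ) (hδ0 : 0 < δ) (hδ1 : δ < 1) :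
    1 - δ ≤ ∑ ω : Fin n → S,
      (if |∑ y, (P y - ((Finset.univ.filter (fun i => ω i = y)).card : ℝ) / n) * f y|
            ≤ Real.sqrt (2 * (∑ y, (((Finset.univ.filter (fun i => ω i = y)).card : ℝ) / n)
                  * f y ^ 2
                - (∑ y, (((Finset.univ.filter (fun i => ω i = y)).card : ℝ) / n) * f y) ^ 2)
                * Real.log (2 / δ) / n)
              + 7 * H * Real.log (2 / δ) / (3 * n)
        then ∏ i, P (ω i) else 0) := by
  have hn0 : 0 < n := by omega
  have hL : Real.log 2 ≤ Real.log (2 / δ) :=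
    Real.log_le_log two_pos (by rw [le_div_iff₀ hδ0]; linarith)
  have hexp : 2 * Real.exp (-Real.log (2 / δ)) = δ := by
    rw [Real.exp_neg, Real.exp_log (by positivity), inv_div]
    ring
  have hgood : ∀ ω : Fin n → S,
      (|∑ y, (P y - ((Finset.univ.filter (fun i => ω i = y)).card : ℝ) / n) * f y|
            ≤ Real.sqrt (2 * (∑ y, (((Finset.univ.filter (fun i => ω i = y)).card : ℝ) / n)
                  * f y ^ 2
                - (∑ y, (((Finset.univ.filter (fun i => ω i = y)).card : ℝ) / n) * f y) ^ 2)
                * Real.log (2 / δ) / n)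
              + 7 * H * Real.log (2 / δ) / (3 * n)) ↔
      ¬ √(2 * ((∑ i, f (ω i) ^ 2) / n - ((∑ i, f (ω i)) / n) ^ 2) * Real.log (2 / δ) / n)
        + 7 * H * Real.log (2 / δ) / (3 * n) < |∑ y, P y * f y - (∑ i, f (ω i)) / n| := by
    intro ω
    simp_rw [sub_mul, Finset.sum_sub_distrib]
    rw [EmpiricalBernstein.sum_card_div_mul ω f,
      EmpiricalBernstein.sum_card_div_mul ω fun y => f y ^ 2, not_lt]
  have hsum := EmpiricalBernstein.prodProb_compl (n := n) hP1 fun ω =>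
    |∑ y, (P y - ((Finset.univ.filter (fun i => ω i = y)).card : ℝ) / n) * f y|
            ≤ Real.sqrt (2 * (∑ y, (((Finset.univ.filter (fun i => ω i = y)).card : ℝ) / n)
                  * f y ^ 2
                - (∑ y, (((Finset.univ.filter (fun i => ω i = y)).card : ℝ) / n) * f y) ^ 2)
                * Real.log (2 / δ) / n)
              + 7 * H * Real.log (2 / δ) / (3 * n)
  simp_rw [hgood, not_not] at hsum ⊢
  have hH0 : 0 ≤ H := by
    by_contra! hH
    have : ∀ y, False := fun y : S => by linarith [hf0 y, hfH y]
    have : IsEmpty S := ⟨this⟩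
    simp at hP1
  refine le_trans ?_ (le_of_eq (hsum.symm.trans (Finset.sum_congr rfl fun ω _ => by congr)))
  rcases hH0.eq_or_lt with rfl | hH
  · have hf : ∀ y, f y = 0 := fun y => le_antisymm (hfH y) (hf0 y)
    simp [hf, EmpiricalBernstein.prodProb, hδ0.le]
  · linarith [EmpiricalBernstein.prodProb_abs_mean_gt_le (n := n) hP0 hP1 hn0 hL hH hf0 hfH]
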